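/- arXiv:1908.03294 — 2 statements merged into one kernel-verified Lean document; each statement's English description precedes it below -/
import Mathlib

section
/- Suppose q ∈ {2,3}, k ≥ 2 and d₀ is a positive integer. If there is no LCD [n,k,d] code over 𝔽_q with d ≥ d₀ and dual distance d⊥ ≥ 2, then there is no LCD [n,k,d] code over 𝔽_q with d ≥ d₀ and dual distance exactly 1. -/
open Matrix Finset

/-- The (Hamming) weight of a vector. -/
def wt {R : Type*} [Zero R] [DecidableEq R] {n : ℕ} (x : Fin n → R) : ℕ :=
  (Finset.univ.filter fun i => x i ≠ 0).card

/-- The dual code of a linear code, w.r.t. the standard inner product. -/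
def dualCode {R : Type*} [CommRing R] {n : ℕ} (C : Submodule R (Fin n → R)) :
    Submodule R (Fin n → R) where
  carrier := {x | ∀ y ∈ C, ∑ i, x i * y i = 0}
  add_mem' := by
    intro a b ha hb y hy
    have ha' := ha y hy
    have hb' := hb y hy
    simp only [Set.mem_setOf_eq, Pi.add_apply, add_mul, Finset.sum_add_distrib, ha', hb',
      add_zero]
  zero_mem' := by intro y hy; simp
  smul_mem' := by
    intro c x hx y hy
    have h := hx y hy
    simp only [Set.mem_setOf_eq, Pi.smul_apply, smul_eq_mul, mul_assoc, ← Finset.mul_sum, h,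
      mul_zero]

/-- A linear code is LCD if it intersects its dual trivially. -/
def IsLCD {R : Type*} [CommRing R] {n : ℕ} (C : Submodule R (Fin n → R)) : Prop :=
  C ⊓ dualCode C = ⊥

/-- `C` has minimum weight `d`. -/
def HasMinWeight {R : Type*} [CommRing R] [DecidableEq R] {n : ℕ}
    (C : Submodule R (Fin n → R)) (d : ℕ) : Prop :=
  (∃ x ∈ C, x ≠ 0 ∧ wt x = d) ∧ ∀ x ∈ C, x ≠ 0 → d ≤ wt x

/-- The dual distance of `C` is at least `d`. -/
def DualDistGe {R : Type*} [CommRing R] [DecidableEq R] {n : ℕ}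
    (C : Submodule R (Fin n → R)) (d : ℕ) : Prop :=
  ∀ x ∈ dualCode C, x ≠ 0 → d ≤ wt x

/-- A monomial matrix: exactly one nonzero entry in each row and column. -/
def IsMonomial {R : Type*} [CommRing R] {n : ℕ} (P : Matrix (Fin n) (Fin n) R) : Prop :=
  ∃ (σ : Equiv.Perm (Fin n)) (c : Fin n → R), (∀ i, c i ≠ 0) ∧
    ∀ i j, P i j = if σ i = j then c i else 0

/-- Two codes of the same length are equivalent if one is the image of the other
under (right) multiplication by a monomial matrix. -/
def codeEquiv {R : Type*} [CommRing R] {n : ℕ} (C₁ C₂ : Submodule R (Fin n → R)) : Prop :=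
  ∃ P : Matrix (Fin n) (Fin n) R, IsMonomial P ∧ C₂ = C₁.map (Matrix.vecMulLinear P)

/-- `G` is a generator matrix of `C`: the rows of `G` form a basis of `C`. -/
def IsGenMatrix {R : Type*} [CommRing R] {k n : ℕ} (C : Submodule R (Fin n → R))
    (G : Matrix (Fin k) (Fin n) R) : Prop :=
  LinearIndependent R (fun i : Fin k => G i) ∧
    Submodule.span R (Set.range fun i : Fin k => G i) = C

/-- The code generated by the rows of a matrix. -/
def rowSpace {R : Type*} [CommRing R] {k n : ℕ} (G : Matrix (Fin k) (Fin n) R) :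
    Submodule R (Fin n → R) :=
  Submodule.span R (Set.range fun i : Fin k => G i)

/-- `[k]_q = (q^k - 1)/(q - 1) = 1 + q + ⋯ + q^(k-1)`. -/
def qrep (q k : ℕ) : ℕ := ∑ i ∈ Finset.range k, q ^ i

/-- The columns of the simplex-code generator matrix `S_{q,k}`, defined inductively. -/
def simplexCol (q : ℕ) : (k : ℕ) → ℕ → (Fin k → ZMod q)
  | 0, _ => fun i => i.elim0
  | (k+1), j =>
    if j < qrep q k then Fin.snoc (simplexCol q k j) 0
    else if j = qrep q k then Fin.snoc (fun _ => 0) 1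
    else Fin.snoc (simplexCol q k ((j - qrep q k - 1) % qrep q k))
      (((j - qrep q k - 1) / qrep q k + 1 : ℕ) : ZMod q)

/-- The generator matrix `S_{q,k}` of the simplex code. -/
def simplexMatrix (q k : ℕ) : Matrix (Fin k) (Fin (qrep q k)) (ZMod q) :=
  Matrix.of fun i j => simplexCol q k (j : ℕ) i

/-- Juxtaposition `(A | B)` of two matrices. -/
def hcat {R : Type*} {k a b : ℕ} (A : Matrix (Fin k) (Fin a) R) (B : Matrix (Fin k) (Fin b) R) :
    Matrix (Fin k) (Fin (a + b)) R :=
  Matrix.of fun i j =>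
    if h : (j : ℕ) < a then A i ⟨j, h⟩ else B i ⟨(j : ℕ) - a, by have := j.isLt; omega⟩

/-- `A^{(s)}`: juxtaposition of `s` copies of `A`. -/
def reps {R : Type*} {k r : ℕ} (A : Matrix (Fin k) (Fin r) R) (s : ℕ) :
    Matrix (Fin k) (Fin (r * s)) R :=
  Matrix.of fun i j => A i ⟨(j : ℕ) % r,
    Nat.mod_lt _ (Nat.pos_of_ne_zero fun hr => by subst hr; simpa using j.isLt)⟩

/-- The list of columns of `G_{q,k}(m)`: `m i` copies of the `i`-th column of `S_{q,k}`. -/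
def colList (q k : ℕ) (m : Fin (qrep q k) → ℕ) : List (Fin k → ZMod q) :=
  (List.finRange (qrep q k)).flatMap fun i => List.replicate (m i) (simplexCol q k (i : ℕ))

lemma colList_length (q k : ℕ) (m : Fin (qrep q k) → ℕ) :
    (colList q k m).length = ∑ i, m i := by
  simp [colList, List.length_flatMap, Function.comp_def]
  rw [← List.ofFn_eq_map, List.sum_ofFn]

/-- The matrix `G_{q,k}(m)`, consisting of `m i` copies of the `i`-th column of `S_{q,k}`. -/
def Gqk (q k : ℕ) (m : Fin (qrep q k) → ℕ) : Matrix (Fin k) (Fin (∑ i, m i)) (ZMod q) :=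
  Matrix.of fun i j => (colList q k m).get (Fin.cast (colList_length q k m).symm j) i

lemma mem_dualCode {R : Type*} [CommRing R] {n : ℕ} {C : Submodule R (Fin n → R)}
    {x : Fin n → R} : x ∈ dualCode C ↔ ∀ y ∈ C, x ⬝ᵥ y = 0 :=
  Iff.rfl

lemma isLCD_iff {R : Type*} [CommRing R] {n : ℕ} {C : Submodule R (Fin n → R)} :
    IsLCD C ↔ ∀ x ∈ C, (∀ y ∈ C, x ⬝ᵥ y = 0) → x = 0 := by
  simp only [IsLCD, Submodule.eq_bot_iff, Submodule.mem_inf, mem_dualCode, and_imp]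

/-- The coordinates at which every codeword vanishes. -/
def zeroCoords {R : Type*} [CommRing R] {n : ℕ} (C : Submodule R (Fin n → R)) : Set (Fin n) :=
  {j | ∀ x ∈ C, x j = 0}

/-- The transvection `x ↦ x + (x ⬝ w) e_j`. -/
def addDotAt {R : Type*} [CommRing R] {n : ℕ} (w : Fin n → R) (j : Fin n) :
    (Fin n → R) →ₗ[R] (Fin n → R) where
  toFun x := x + (x ⬝ᵥ w) • Pi.single j 1
  map_add' x y := by rw [add_dotProduct, add_smul]; abel
  map_smul' c x := by simp [smul_dotProduct, smul_smul]

section addDotAt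

variable {R : Type*} [CommRing R] {n : ℕ}

lemma addDotAt_apply (w x : Fin n → R) (j : Fin n) :
    addDotAt w j x = x + (x ⬝ᵥ w) • Pi.single j 1 := rfl

lemma addDotAt_apply_of_ne (w x : Fin n → R) {i j : Fin n} (hij : i ≠ j) :
    addDotAt w j x i = x i := by
  simp [addDotAt_apply, hij]

lemma addDotAt_apply_self (w x : Fin n → R) (j : Fin n) :
    addDotAt w j x j = x j + x ⬝ᵥ w := by
  simp [addDotAt_apply]

lemma addDotAt_dotProduct {w x y : Fin n → R} {j : Fin n} (hx : x j = 0) (hy : y j = 0) :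
    addDotAt w j x ⬝ᵥ addDotAt w j y = x ⬝ᵥ y + (x ⬝ᵥ w) * (y ⬝ᵥ w) := by
  simp [addDotAt_apply, hx, hy, mul_comm]

lemma wt_le_wt_addDotAt [DecidableEq R] {w x : Fin n → R} {j : Fin n} (hx : x j = 0) :
    wt x ≤ wt (addDotAt w j x) := by
  refine Finset.card_le_card fun i hi => ?_
  simp only [Finset.mem_filter, Finset.mem_univ, true_and] at hi ⊢
  rwa [addDotAt_apply_of_ne w x (by rintro rfl; exact hi hx)]

lemma eq_zero_of_addDotAt_eq_zero {w x : Fin n → R} {j : Fin n} (hx : x j = 0)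
    (h : addDotAt w j x = 0) : x = 0 := by
  ext i
  by_cases hij : i = j
  · rw [hij, hx, Pi.zero_apply]
  · rw [← addDotAt_apply_of_ne w x hij, h]

end addDotAt

section Field

variable {K : Type*} [Field K] {n : ℕ} {C : Submodule K (Fin n → K)} {w : Fin n → K} {j : Fin n}

lemma finrank_map_addDotAt (hj : j ∈ zeroCoords C) :
    Module.finrank K (C.map (addDotAt w j)) = Module.finrank K C := by
  rw [← LinearMap.range_domRestrict]
  refine LinearMap.finrank_range_of_inj ?_
  rw [injective_iff_map_eq_zero]
  rintro ⟨x, hx⟩ h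
  exact Subtype.ext (eq_zero_of_addDotAt_eq_zero (hj x hx) h)

lemma IsLCD.map_addDotAt (hC : IsLCD C) (hj : j ∈ zeroCoords C) (hw : w ∈ C)
    (hww : w ⬝ᵥ w ≠ -1) : IsLCD (C.map (addDotAt w j)) := by
  rw [isLCD_iff] at hC ⊢
  rintro _ ⟨x, hx, rfl⟩ h
  have hrad : x + (x ⬝ᵥ w) • w = 0 := by
    refine hC _ (C.add_mem hx (C.smul_mem _ hw)) fun y hy => ?_
    have := h _ (Submodule.mem_map_of_mem hy)
    rw [addDotAt_dotProduct (hj x hx) (hj y hy)] at this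
    rwa [add_dotProduct, smul_dotProduct, smul_eq_mul, dotProduct_comm w y]
  have hxw : (x ⬝ᵥ w) * (1 + w ⬝ᵥ w) = 0 := by
    have := congrArg (· ⬝ᵥ w) hrad
    simp only [add_dotProduct, smul_dotProduct, smul_eq_mul, zero_dotProduct] at this
    linear_combination this
  have hne : 1 + w ⬝ᵥ w ≠ 0 := fun h0 => hww (by linear_combination h0)
  have hx0 : x ⬝ᵥ w = 0 := (mul_eq_zero.mp hxw).resolve_right hne
  rw [hx0, zero_smul, add_zero] at hrad
  rw [hrad, map_zero]

lemma zeroCoords_map_addDotAt_ssubset (hC : IsLCD C) (hj : j ∈ zeroCoords C) (hw : w ∈ C)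
    (hw0 : w ≠ 0) : zeroCoords (C.map (addDotAt w j)) ⊂ zeroCoords C := by
  have hj' : j ∉ zeroCoords (C.map (addDotAt w j)) := fun h =>
    hw0 <| isLCD_iff.mp hC w hw fun y hy => by
      have := h _ (Submodule.mem_map_of_mem hy)
      rwa [addDotAt_apply_self, hj y hy, zero_add, dotProduct_comm] at this
  refine ⟨fun i hi x hx => ?_, fun h => hj' (h hj)⟩
  rw [← addDotAt_apply_of_ne w x (ne_of_mem_of_not_mem hi hj')]
  exact hi _ (Submodule.mem_map_of_mem hx)

lemma dualDistGe_two_of_zeroCoords_eq_empty [DecidableEq K] (hC : zeroCoords C = ∅) :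
    DualDistGe C 2 := by
  intro x hx hx0
  by_contra! hlt
  obtain ⟨j, hj⟩ := Function.ne_iff.mp hx0
  have hxi : ∀ i, i ≠ j → x i = 0 := by
    intro i hij
    by_contra hi
    exact hij (Finset.card_le_one.mp (Nat.le_of_lt_succ hlt) i (by simpa using hi) j
      (by simpa using hj))
  refine Set.notMem_empty j (hC ▸ fun y hy => ?_)
  have hsum : ∑ i, x i * y i = 0 := hx y hy
  rw [Finset.sum_eq_single j (fun i _ hij => by rw [hxi i hij, zero_mul]) (by simp)] at hsum
  exact (mul_eq_zero.mp hsum).resolve_left hj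

lemma exists_hasMinWeight [DecidableEq K] (hC : C ≠ ⊥) : ∃ d, HasMinWeight C d := by
  classical
  have hex : ∃ d, ∃ x ∈ C, x ≠ 0 ∧ wt x = d := by
    obtain ⟨x, hx, hx0⟩ := C.exists_mem_ne_zero_of_ne_bot hC
    exact ⟨_, x, hx, hx0, rfl⟩
  exact ⟨Nat.find hex, Nat.find_spec hex,
    fun x hx hx0 => Nat.find_min' hex ⟨x, hx, hx0, rfl⟩⟩

end Field

lemma exists_dotProduct_self_ne_neg_one {q n : ℕ} (hq : q = 2 ∨ q = 3)
    {C : Submodule (ZMod q) (Fin n → ZMod q)} (hC : 2 ≤ Module.finrank (ZMod q) C) :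
    ∃ w ∈ C, w ≠ 0 ∧ w ⬝ᵥ w ≠ -1 := by
  have : Fact q.Prime := ⟨by rcases hq with rfl | rfl <;> norm_num⟩
  obtain ⟨f, hf⟩ := exists_linearIndependent_of_le_finrank hC
  have hpair : ∀ s t : ZMod q, s • f 0 + t • f 1 = 0 → s = 0 ∧ t = 0 := fun s t h => by
    have hg := Fintype.linearIndependent_iff.mp hf ![s, t] (by simpa [Fin.sum_univ_two] using h)
    exact ⟨hg 0, hg 1⟩
  by_contra! hall
  set u : Fin n → ZMod q := (f 0).1
  set v : Fin n → ZMod q := (f 1).1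
  have key : ∀ s t : ZMod q, (s ≠ 0 ∨ t ≠ 0) →
      s * s * (u ⬝ᵥ u) + 2 * s * t * (u ⬝ᵥ v) + t * t * (v ⬝ᵥ v) = -1 := by
    intro s t hst
    rw [← hall (s • u + t • v) (s • f 0 + t • f 1).2 fun h0 => by
      have := hpair s t (Subtype.ext h0)
      tauto]
    simp only [add_dotProduct, dotProduct_add, smul_dotProduct, dotProduct_smul, smul_eq_mul]
    rw [dotProduct_comm v u]
    ring
  have h10 := key 1 0 (by simp)
  have h01 := key 0 1 (by simp)
  have h11 := key 1 1 (by simp)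
  have h12 := key 1 (-1) (by simp)
  have h2 : (2 : ZMod q) = 0 := by linear_combination 2 * h10 + 2 * h01 - h11 - h12
  have h1 : (1 : ZMod q) = 0 := by
    linear_combination h10 + h01 - h11 + (u ⬝ᵥ v) * h2
  exact one_ne_zero h1

lemma exists_isLCD_zeroCoords_eq_empty {q k n d₀ : ℕ} (hq : q = 2 ∨ q = 3) (hk : 2 ≤ k)
    (C : Submodule (ZMod q) (Fin n → ZMod q)) (hrank : Module.finrank (ZMod q) C = k)
    (hC : IsLCD C) (hwt : ∀ x ∈ C, x ≠ 0 → d₀ ≤ wt x) :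
    ∃ C' : Submodule (ZMod q) (Fin n → ZMod q), Module.finrank (ZMod q) C' = k ∧ IsLCD C' ∧
      (∀ x ∈ C', x ≠ 0 → d₀ ≤ wt x) ∧ zeroCoords C' = ∅ := by
  have : Fact q.Prime := ⟨by rcases hq with rfl | rfl <;> norm_num⟩
  induction hz : (zeroCoords C).ncard using Nat.strong_induction_on generalizing C with
  | _ m ih =>
    obtain hempty | ⟨j, hj⟩ := (zeroCoords C).eq_empty_or_nonempty
    · exact ⟨C, hrank, hC, hwt, hempty⟩
    obtain ⟨w, hw, hw0, hww⟩ := exists_dotProduct_self_ne_neg_one hq (hrank ▸ hk)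
    refine ih _ ?_ (C.map (addDotAt w j)) ((finrank_map_addDotAt hj).trans hrank)
      (hC.map_addDotAt hj hw hww) ?_ rfl
    · rw [← hz]
      exact Set.ncard_lt_ncard (zeroCoords_map_addDotAt_ssubset hC hj hw hw0)
    · rintro _ ⟨x, hx, rfl⟩ hne
      exact (hwt x hx fun h => hne (by rw [h, map_zero])).trans (wt_le_wt_addDotAt (hj x hx))

/-- If there is no LCD `[n,k,d]` code over `𝔽_q` with `d ≥ d₀` and dual distance `≥ 2`,
then there is no LCD `[n,k,d]` code with `d ≥ d₀` and dual distance exactly `1`. -/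
theorem no_lcd_dual_distance_one {q k n d₀ : ℕ} (hq : q = 2 ∨ q = 3) (hk : 2 ≤ k)
    (hd₀ : 1 ≤ d₀)
    (h : ¬ ∃ (C : Submodule (ZMod q) (Fin n → ZMod q)) (d : ℕ), d₀ ≤ d ∧
      Module.finrank (ZMod q) C = k ∧ IsLCD C ∧ HasMinWeight C d ∧ DualDistGe C 2) :
    ¬ ∃ (C : Submodule (ZMod q) (Fin n → ZMod q)) (d : ℕ), d₀ ≤ d ∧
      Module.finrank (ZMod q) C = k ∧ IsLCD C ∧ HasMinWeight C d ∧
      HasMinWeight (dualCode C) 1 := by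
  have : Fact q.Prime := ⟨by rcases hq with rfl | rfl <;> norm_num⟩
  rintro ⟨C, d, hd, hrank, hC, hmin, -⟩
  obtain ⟨C', hrank', hC', hwt', hz⟩ := exists_isLCD_zeroCoords_eq_empty hq hk C hrank hC
    fun x hx hx0 => hd.trans (hmin.2 x hx hx0)
  obtain ⟨d', hd'⟩ := exists_hasMinWeight (C := C') fun hbot => by
    rw [hbot, finrank_bot] at hrank'
    omega
  obtain ⟨x, hx, hx0, hxd⟩ := hd'.1
  exact h ⟨C', d', hxd ▸ hwt' x hx hx0, hrank', hC', hd',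
    dualDistGe_two_of_zeroCoords_eq_empty hz⟩
end

section
/- Suppose (q,k₀) ∈ {(2,3),(3,2)}, k ≥ k₀ and q·d − (q−1)·n ≥ 1, and let r = r_{q,n,k,d} = q^{k−1}·n − [k]_q·d. If there is an LCD [n,k,d] code C over 𝔽_q with dual distance d(C⊥) ≥ 2, then there is an LCD [n,k,d] code C′ over 𝔽_q such that C is equivalent to C′ and C′ has a generator matrix of the form (S_{q,k}^{(qd−(q−1)n)} | G₀), where G₀ is a generator matrix of some LCD [q·r, k, (q−1)·r] code over 𝔽_q. -/
open Matrix Finset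

section SimplexPoints

variable {q : ℕ} [Fact q.Prime]

lemma qrep_succ (q k : ℕ) : qrep q (k + 1) = q * qrep q k + 1 := by
  simp [qrep, Finset.sum_range_succ', Finset.mul_sum, pow_succ']

lemma pred_mul_qrep_add_one {q : ℕ} (hq : 1 ≤ q) (k : ℕ) : (q - 1) * qrep q k + 1 = q ^ k := by
  obtain ⟨p, rfl⟩ := Nat.exists_eq_add_of_le' hq
  induction k with
  | zero => simp [qrep]
  | succ k ih =>
    rw [qrep_succ, pow_succ, ← ih]
    simp only [Nat.add_sub_cancel]
    ring

/-- Every nonzero vector is a nonzero multiple of a column of the simplex matrix. -/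
lemma exists_smul_simplexCol (k : ℕ) (v : Fin k → ZMod q) (hv : v ≠ 0) :
    ∃ i < qrep q k, ∃ c : ZMod q, c ≠ 0 ∧ v = c • simplexCol q k i := by
  induction k with
  | zero => exact absurd (Subsingleton.elim _ _) hv
  | succ k ih =>
    have hq : 2 ≤ q := (Fact.out : q.Prime).two_le
    obtain ⟨w, a, rfl⟩ : ∃ (w : Fin k → ZMod q) (a : ZMod q),
        v = (Fin.snoc w a : Fin (k + 1) → ZMod q) :=
      ⟨Fin.init v, v (Fin.last k), (Fin.snoc_init_self v).symm⟩
    have hsmul : ∀ (c b : ZMod q) (u : Fin k → ZMod q),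
        c • (Fin.snoc u b : Fin (k + 1) → ZMod q) = Fin.snoc (c • u) (c * b) := by
      intro c b u
      ext j
      refine Fin.lastCases ?_ (fun j => ?_) j <;> simp
    by_cases hw : w = 0
    · subst hw
      have ha : a ≠ 0 := by
        rintro rfl
        apply hv
        ext j
        refine Fin.lastCases ?_ (fun j => ?_) j <;> simp
      refine ⟨qrep q k, by rw [qrep_succ]; nlinarith, a, ha, ?_⟩
      have : simplexCol q (k + 1) (qrep q k) = Fin.snoc (fun _ => 0) 1 := by
        simp [simplexCol]
      rw [this, hsmul]
      congr 1
      · ext; simp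
      · simp
    · obtain ⟨i, hi, c, hc, rfl⟩ := ih w hw
      by_cases ha : a = 0
      · subst ha
        refine ⟨i, by rw [qrep_succ]; nlinarith, c, hc, ?_⟩
        have : simplexCol q (k + 1) i = Fin.snoc (simplexCol q k i) 0 := by
          simp [simplexCol, hi]
        rw [this, hsmul, mul_zero]
      · set t : ZMod q := c⁻¹ * a with ht
        have ht0 : t ≠ 0 := mul_ne_zero (inv_ne_zero hc) ha
        have htv : 1 ≤ t.val := Nat.one_le_iff_ne_zero.2 fun h => ht0 ((ZMod.val_eq_zero t).1 h)
        have htq : t.val < q := ZMod.val_lt t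
        obtain ⟨s, hs⟩ : ∃ s, t.val = s + 1 := ⟨t.val - 1, by omega⟩
        refine ⟨qrep q k + 1 + (i + qrep q k * s), ?_, c, hc, ?_⟩
        · rw [qrep_succ]
          have : s + 2 ≤ q := by omega
          nlinarith
        · have h1 : qrep q k + 1 + (i + qrep q k * s) - qrep q k - 1 = i + qrep q k * s := by omega
          have hcol : simplexCol q (k + 1) (qrep q k + 1 + (i + qrep q k * s)) =
              Fin.snoc (simplexCol q k i) t := by
            rw [simplexCol, if_neg (by omega), if_neg (by omega), h1,
              Nat.add_mul_mod_self_left, Nat.mod_eq_of_lt hi,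
              Nat.add_mul_div_left _ _ (by omega), Nat.div_eq_of_lt hi, zero_add, ← hs,
              ZMod.natCast_zmod_val]
          rw [hcol, hsmul, ht, mul_inv_cancel_left₀ hc]

lemma simplexCol_bijective (k : ℕ) : Function.Bijective
    fun o : Option ((ZMod q)ˣ × Fin (qrep q k)) =>
      o.elim (0 : Fin k → ZMod q) fun p => (p.1 : ZMod q) • simplexCol q k p.2 := by
  rw [Fintype.bijective_iff_surjective_and_card]
  constructor
  · intro v
    by_cases hv : v = 0
    · exact ⟨none, hv.symm⟩
    · obtain ⟨i, hi, c, hc, rfl⟩ := exists_smul_simplexCol k v hv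
      exact ⟨some (Units.mk0 c hc, ⟨i, hi⟩), rfl⟩
  · rw [Fintype.card_option, Fintype.card_prod, ZMod.card_units, Fintype.card_fin,
      pred_mul_qrep_add_one (Fact.out : q.Prime).one_le]
    simp [ZMod.card]

lemma simplexCol_ne_zero {k : ℕ} (i : Fin (qrep q k)) : simplexCol q k i ≠ 0 := by
  intro h
  have := (simplexCol_bijective (q := q) k).injective.eq_iff (a := some (1, i)) (b := none)
  simp [h] at this

lemma eq_of_smul_simplexCol_eq {k : ℕ} {i j : Fin (qrep q k)} {c : ZMod q} (hc : c ≠ 0)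
    (h : simplexCol q k i = c • simplexCol q k j) : i = j := by
  have := (simplexCol_bijective (q := q) k).injective.eq_iff (a := some (1, i))
    (b := some (Units.mk0 c hc, j))
  simp only [Option.some.injEq, Prod.mk.injEq] at this
  exact (this.1 (by simpa using h)).2

/-- A sum over all vectors of a function that is constant on punctured lines through the origin
reduces to a sum over the columns of the simplex matrix. -/
lemma sum_eq_nsmul_sum_simplexCol {M : Type*} [AddCommMonoid M] {k : ℕ}
    (f : (Fin k → ZMod q) → M) (h0 : f 0 = 0)
    (hf : ∀ (c : ZMod q) (v), c ≠ 0 → f (c • v) = f v) :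
    ∑ v, f v = (q - 1) • ∑ i : Fin (qrep q k), f (simplexCol q k i) := by
  rw [← (simplexCol_bijective (q := q) k).sum_comp f, Fintype.sum_option, Fintype.sum_prod_type]
  simp [h0, hf, Finset.card_univ, Nat.totient_prime (Fact.out : q.Prime)]

end SimplexPoints

lemma ZMod.mul_self_eq_one_of_ne_zero {q : ℕ} (hq : q = 2 ∨ q = 3) (c : ZMod q) (hc : c ≠ 0) :
    c * c = 1 := by
  revert c
  obtain rfl | rfl := hq
  · decide
  · decide

section Counting

variable {q : ℕ} [Fact q.Prime] {k : ℕ}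

/-- On a set of vectors invariant under translation along `u`, a linear form that does not vanish
at `u` is nonzero with proportion `(q - 1) / q`. -/
lemma mul_card_dotProduct_ne_zero (P : (Fin k → ZMod q) → Prop) [DecidablePred P]
    (g u : Fin k → ZMod q) (hP : ∀ (t : ZMod q) (x), P (x + t • u) ↔ P x) (hu : u ⬝ᵥ g ≠ 0) :
    q * (univ.filter fun x => P x ∧ x ⬝ᵥ g ≠ 0).card = (q - 1) * (univ.filter P).card := by
  have h1 : ∀ t : ZMod q, (univ.filter fun x => P x ∧ x ⬝ᵥ g ≠ 0).card =
      ∑ x, if P x ∧ x ⬝ᵥ g + t * (u ⬝ᵥ g) ≠ 0 then 1 else 0 := by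
    intro t
    rw [Finset.card_filter, ← Equiv.sum_comp (Equiv.addRight (t • u))]
    simp [hP, add_dotProduct]
  have h2 : ∀ a : ZMod q,
      (∑ t : ZMod q, if a + t * (u ⬝ᵥ g) ≠ 0 then 1 else 0) = q - 1 := by
    intro a
    have hb : Function.Bijective fun t : ZMod q => a + t * (u ⬝ᵥ g) :=
      (Equiv.addLeft a).bijective.comp (mulRight_bijective₀ _ hu)
    rw [hb.sum_comp fun s : ZMod q => if s ≠ 0 then 1 else 0, ← Finset.card_filter,
      Finset.filter_ne', Finset.card_erase_of_mem (Finset.mem_univ _), Finset.card_univ,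
      ZMod.card]
  calc q * (univ.filter fun x => P x ∧ x ⬝ᵥ g ≠ 0).card
      = ∑ t : ZMod q, (univ.filter fun x => P x ∧ x ⬝ᵥ g ≠ 0).card := by simp [ZMod.card]
    _ = ∑ x, ∑ t : ZMod q, if P x ∧ x ⬝ᵥ g + t * (u ⬝ᵥ g) ≠ 0 then 1 else 0 := by
      rw [Finset.sum_comm]
      exact Finset.sum_congr rfl fun t _ => h1 t
    _ = ∑ x, if P x then q - 1 else 0 := by
      refine Finset.sum_congr rfl fun x _ => ?_
      by_cases hx : P x
      · simpa [hx] using h2 (x ⬝ᵥ g)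
      · simp [hx]
    _ = (q - 1) * (univ.filter P).card := by
      rw [← Finset.sum_filter, Finset.sum_const, smul_eq_mul, mul_comm]

lemma exists_dotProduct_ne_zero {F : Type*} [Field F] {g : Fin k → F} (hg : g ≠ 0) :
    ∃ u, u ⬝ᵥ g ≠ 0 := by
  obtain ⟨j, hj⟩ := Function.ne_iff.1 hg
  exact ⟨Pi.single j 1, by simpa using hj⟩

lemma mul_card_dotProduct_ne_zero_univ {g : Fin k → ZMod q} (hg : g ≠ 0) :
    q * (univ.filter fun x : Fin k → ZMod q => x ⬝ᵥ g ≠ 0).card = (q - 1) * q ^ k := by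
  obtain ⟨u, hu⟩ := exists_dotProduct_ne_zero hg
  simpa [ZMod.card] using mul_card_dotProduct_ne_zero (fun _ => True) g u (by simp) hu

lemma exists_dotProduct_eq_zero_ne_zero {F : Type*} [Field F] {h g : Fin k → F} (hh : h ≠ 0)
    (hg : ∀ c : F, g ≠ c • h) : ∃ u, u ⬝ᵥ h = 0 ∧ u ⬝ᵥ g ≠ 0 := by
  obtain ⟨a, ha⟩ := Function.ne_iff.1 hh
  obtain ⟨b, hb⟩ := Function.ne_iff.1 (hg (g a / h a))
  refine ⟨Pi.single b (h a) - Pi.single a (h b), ?_, ?_⟩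
  · simp [sub_dotProduct, mul_comm]
  · simp only [sub_dotProduct, single_dotProduct]
    intro h0
    apply hb
    have ha' : h a ≠ 0 := ha
    simp only [Pi.smul_apply, smul_eq_mul]
    field_simp
    linear_combination h0

/-- A projective multiset of `n` points all of whose hyperplane complements have at least `d`
points contains every point with multiplicity at least `q * d - (q - 1) * n`. -/
lemma multiplicity_lower_bound {n d : ℕ} (g : Fin n → Fin k → ZMod q) (hg : ∀ j, g j ≠ 0)
    (hd : ∀ x : Fin k → ZMod q, x ≠ 0 → d ≤ (univ.filter fun j => x ⬝ᵥ g j ≠ 0).card)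
    {h : Fin k → ZMod q} (hh : h ≠ 0) :
    q * d ≤ (univ.filter fun j => ∃ c : ZMod q, g j = c • h).card + (q - 1) * n := by
  classical
  have hq : 2 ≤ q := (Fact.out : q.Prime).two_le
  set H : Finset (Fin k → ZMod q) := univ.filter fun x => x ⬝ᵥ h ≠ 0 with hH
  have hHpos : 0 < H.card := by
    have := mul_card_dotProduct_ne_zero_univ hh
    have h2 : 0 < (q - 1) * q ^ k := Nat.mul_pos (by omega) (by positivity)
    rw [← this] at h2
    exact Nat.pos_of_mul_pos_left h2
  have hcol : ∀ j, q * (univ.filter fun x => x ⬝ᵥ h ≠ 0 ∧ x ⬝ᵥ g j ≠ 0).card =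
      ((if ∃ c : ZMod q, g j = c • h then 1 else 0) + (q - 1)) * H.card := by
    intro j
    split_ifs with hj
    · obtain ⟨c, hc⟩ := hj
      have hc0 : c ≠ 0 := by
        rintro rfl
        exact hg j (by simpa using hc)
      rw [show 1 + (q - 1) = q by omega, hH]
      simp [hc, hc0]
    · push Not at hj
      obtain ⟨u, hu, hu'⟩ := exists_dotProduct_eq_zero_ne_zero hh hj
      rw [zero_add]
      exact mul_card_dotProduct_ne_zero (fun x => x ⬝ᵥ h ≠ 0) (g j) u
        (by simp [add_dotProduct, hu]) hu'
  have hsum : ∑ x ∈ H, (univ.filter fun j => x ⬝ᵥ g j ≠ 0).card =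
      ∑ j, (univ.filter fun x => x ⬝ᵥ h ≠ 0 ∧ x ⬝ᵥ g j ≠ 0).card := by
    simp only [Finset.card_filter]
    rw [Finset.sum_comm]
    refine Finset.sum_congr rfl fun j _ => ?_
    rw [hH, Finset.sum_filter]
    refine Finset.sum_congr rfl fun x _ => ?_
    by_cases hx : x ⬝ᵥ h = 0 <;> simp [hx]
  have hle : H.card * d ≤ ∑ x ∈ H, (univ.filter fun j => x ⬝ᵥ g j ≠ 0).card := by
    rw [← smul_eq_mul]
    refine Finset.card_nsmul_le_sum _ _ _ fun x hx => hd x ?_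
    rintro rfl
    simp [hH] at hx
  have key : q * (H.card * d) ≤
      ((univ.filter fun j => ∃ c : ZMod q, g j = c • h).card + (q - 1) * n) * H.card := by
    refine (Nat.mul_le_mul_left q hle).trans_eq ?_
    rw [hsum, Finset.mul_sum, Finset.sum_congr rfl fun j _ => hcol j, ← Finset.sum_mul,
      Finset.sum_add_distrib, ← Finset.card_filter]
    simp [mul_comm]
  refine Nat.le_of_mul_le_mul_right ?_ hHpos
  linarith

/-- The nonzero codewords of the simplex code have weight `q ^ (k - 1)`. -/
lemma mul_card_simplexCol_dotProduct_ne_zero {x : Fin k → ZMod q} (hx : x ≠ 0) :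
    q * (univ.filter fun i : Fin (qrep q k) => x ⬝ᵥ simplexCol q k i ≠ 0).card = q ^ k := by
  have hq : 2 ≤ q := (Fact.out : q.Prime).two_le
  have h1 := mul_card_dotProduct_ne_zero_univ hx
  have h2 := sum_eq_nsmul_sum_simplexCol (M := ℕ)
    (fun v : Fin k → ZMod q => if x ⬝ᵥ v ≠ 0 then 1 else 0) (by simp)
    (fun c v hc => by simp [hc])
  rw [← Finset.card_filter, ← Finset.card_filter, smul_eq_mul] at h2
  simp only [dotProduct_comm _ x] at h1
  rw [h2] at h1
  refine Nat.eq_of_mul_eq_mul_left (show 0 < q - 1 by omega) ?_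
  linarith

/-- The rows of the simplex matrix are self-orthogonal and pairwise orthogonal. -/
lemma sum_simplexCol_mul_simplexCol (hq : q ≤ 3) (hk : 2 < (q - 1) * k) (a b : Fin k) :
    ∑ i : Fin (qrep q k), simplexCol q k i a * simplexCol q k i b = 0 := by
  have hq2 : 2 ≤ q := (Fact.out : q.Prime).two_le
  have h1 := sum_eq_nsmul_sum_simplexCol (fun v : Fin k → ZMod q => v a * v b) (by simp)
    (fun c v hc => by
      simp only [Pi.smul_apply, smul_eq_mul]
      linear_combination (v a * v b) * ZMod.mul_self_eq_one_of_ne_zero (by omega) c hc)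
  have h2 : ∑ v : Fin k → ZMod q, v a * v b = 0 := by
    have hdeg : ((MvPolynomial.X a * MvPolynomial.X b :
        MvPolynomial (Fin k) (ZMod q))).totalDegree ≤ 2 :=
      (MvPolynomial.totalDegree_mul _ _).trans (by simp [MvPolynomial.totalDegree_X])
    have := MvPolynomial.sum_eval_eq_zero
      (MvPolynomial.X a * MvPolynomial.X b : MvPolynomial (Fin k) (ZMod q))
      (by rw [ZMod.card, Fintype.card_fin]; omega)
    simpa using this
  rw [h2, nsmul_eq_mul, Nat.cast_sub (Fact.out : q.Prime).one_le] at h1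
  simpa using h1.symm

end Counting

section GeneratorMatrices

lemma isGenMatrix_iff {F : Type*} [CommRing F] {k n : ℕ} {C : Submodule F (Fin n → F)}
    {G : Matrix (Fin k) (Fin n) F} :
    IsGenMatrix C G ↔ Function.Injective G.vecMul ∧ LinearMap.range G.vecMulLinear = C := by
  rw [Matrix.vecMul_injective_iff, range_vecMulLinear]
  rfl

variable {F : Type*} [Field F] {k n : ℕ} {C : Submodule F (Fin n → F)}
  {G : Matrix (Fin k) (Fin n) F}

lemma IsGenMatrix.vecMul_eq_zero_iff (hG : IsGenMatrix C G) (x : Fin k → F) :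
    x ᵥ* G = 0 ↔ x = 0 :=
  ⟨fun h => (isGenMatrix_iff.1 hG).1 (h.trans (Matrix.zero_vecMul G).symm), by rintro rfl; simp⟩

lemma IsGenMatrix.mem_iff (hG : IsGenMatrix C G) (y : Fin n → F) :
    y ∈ C ↔ ∃ x, x ᵥ* G = y := by
  rw [← (isGenMatrix_iff.1 hG).2, LinearMap.mem_range]
  rfl

lemma IsGenMatrix.finrank_eq (hG : IsGenMatrix C G) : Module.finrank F C = k := by
  rw [← hG.2, finrank_span_eq_card hG.1, Fintype.card_fin]

lemma IsGenMatrix.isLCD_iff (hG : IsGenMatrix C G) :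
    IsLCD C ↔ ∀ x, x ᵥ* (G * Gᵀ) = 0 → x = 0 := by
  have hmem : ∀ x, x ᵥ* G ∈ dualCode C ↔ x ᵥ* (G * Gᵀ) = 0 := by
    intro x
    rw [← dotProduct_eq_zero_iff]
    refine ⟨fun h z => ?_, fun h y hy => ?_⟩
    · have := h (z ᵥ* G) ((hG.mem_iff _).2 ⟨z, rfl⟩)
      rw [← Matrix.vecMul_vecMul, ← Matrix.dotProduct_mulVec, Matrix.mulVec_transpose]
      exact this
    · obtain ⟨z, rfl⟩ := (hG.mem_iff _).1 hy
      have := h z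
      rw [← Matrix.vecMul_vecMul, ← Matrix.dotProduct_mulVec, Matrix.mulVec_transpose] at this
      exact this
  rw [IsLCD, Submodule.eq_bot_iff]
  constructor
  · intro h x hx
    exact (hG.vecMul_eq_zero_iff x).1 (h _ ⟨(hG.mem_iff _).2 ⟨x, rfl⟩, (hmem x).2 hx⟩)
  · rintro h y ⟨hy, hy'⟩
    obtain ⟨x, rfl⟩ := (hG.mem_iff _).1 hy
    rw [h x ((hmem x).1 hy'), Matrix.zero_vecMul]

lemma IsGenMatrix.hasMinWeight_iff [DecidableEq F] (hG : IsGenMatrix C G) (d : ℕ) :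
    HasMinWeight C d ↔ (∃ x, x ≠ 0 ∧ wt (x ᵥ* G) = d) ∧ ∀ x, x ≠ 0 → d ≤ wt (x ᵥ* G) := by
  simp only [HasMinWeight, hG.mem_iff]
  constructor
  · rintro ⟨⟨_, ⟨x, rfl⟩, hx, hw⟩, h⟩
    exact ⟨⟨x, fun h0 => hx (by simp [h0]), hw⟩,
      fun x hx => h _ ⟨x, rfl⟩ ((hG.vecMul_eq_zero_iff x).not.2 hx)⟩
  · rintro ⟨⟨x, hx, hw⟩, h⟩
    refine ⟨⟨_, ⟨x, rfl⟩, (hG.vecMul_eq_zero_iff x).not.2 hx, hw⟩, ?_⟩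
    rintro _ ⟨x, rfl⟩ hx
    exact h x fun h0 => hx (by simp [h0])

/-- A code has a generator matrix with as many rows as its dimension. -/
lemma exists_isGenMatrix (hC : Module.finrank F C = k) :
    ∃ G : Matrix (Fin k) (Fin n) F, IsGenMatrix C G := by
  let b := Module.finBasisOfFinrankEq F C hC
  refine ⟨Matrix.of fun i => (b i : Fin n → F), ?_, ?_⟩
  · exact b.linearIndependent.map' C.subtype C.ker_subtype
  · have : (Set.range fun i => (b i : Fin n → F)) = C.subtype '' Set.range b := by
      rw [← Set.range_comp]
      rfl
    change Submodule.span F (Set.range fun i => (b i : Fin n → F)) = C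
    rw [this, Submodule.span_image, b.span_eq, Submodule.map_top, Submodule.range_subtype]

lemma IsGenMatrix.col_ne_zero [DecidableEq F] (hG : IsGenMatrix C G) (hC : DualDistGe C 2)
    (j : Fin n) : G.col j ≠ 0 := by
  intro h
  have hw := hC (Pi.single j 1) ?_ (by simp)
  · have : wt (Pi.single j (1 : F) : Fin n → F) = 1 := by
      rw [wt, Finset.card_eq_one]
      refine ⟨j, ?_⟩
      ext i
      simp [Pi.single_apply]
    omega
  · intro y hy
    obtain ⟨x, rfl⟩ := (hG.mem_iff _).1 hy
    change Pi.single j 1 ⬝ᵥ (x ᵥ* G) = 0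
    rw [single_dotProduct, one_mul]
    change x ⬝ᵥ G.col j = 0
    rw [h, dotProduct_zero]

/-- Rescaling and permuting the columns of a generator matrix gives a generator matrix of an
equivalent code. -/
lemma IsGenMatrix.exists_codeEquiv (hG : IsGenMatrix C G) {G' : Matrix (Fin k) (Fin n) F}
    (τ : Equiv.Perm (Fin n)) (c : Fin n → F) (hc : ∀ j, c j ≠ 0)
    (hG' : ∀ j, G.col (τ j) = c j • G'.col j) :
    ∃ C' : Submodule F (Fin n → F), codeEquiv C C' ∧ IsGenMatrix C' G' := by
  let P : Matrix (Fin n) (Fin n) F :=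
    Matrix.of fun i j => if τ.symm i = j then (c (τ.symm i))⁻¹ else 0
  have hGP : G * P = G' := by
    ext i j
    have h1 : ∀ l, (τ.symm l = j) ↔ (l = τ j) := fun l => τ.symm_apply_eq
    have h2 : G i (τ j) = c j * G' i j := congrFun (hG' j) i
    simp [Matrix.mul_apply, P, h1, h2, hc, mul_comm]
  have hvec : ∀ x, x ᵥ* G' = (x ᵥ* G) ᵥ* P := fun x => by rw [Matrix.vecMul_vecMul, hGP]
  refine ⟨C.map P.vecMulLinear, ⟨P, ⟨τ.symm, fun i => (c (τ.symm i))⁻¹,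
    fun i => inv_ne_zero (hc _), fun i j => rfl⟩, rfl⟩, isGenMatrix_iff.2 ⟨?_, ?_⟩⟩
  · rw [← Matrix.coe_vecMulLinear, injective_iff_map_eq_zero]
    intro x hx
    refine (hG.vecMul_eq_zero_iff x).1 (funext fun j => ?_)
    obtain ⟨j, rfl⟩ := τ.surjective j
    change x ⬝ᵥ G.col (τ j) = 0
    rw [hG', dotProduct_smul]
    have : x ⬝ᵥ G'.col j = 0 := congrFun hx j
    rw [this, smul_zero]
  · ext y
    simp only [LinearMap.mem_range, Submodule.mem_map, hG.mem_iff, Matrix.vecMulLinear_apply]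
    constructor
    · rintro ⟨x, rfl⟩
      exact ⟨_, ⟨x, rfl⟩, (hvec x).symm⟩
    · rintro ⟨_, ⟨x, rfl⟩, rfl⟩
      exact ⟨x, hvec x⟩

lemma wt_vecMul_of_col [DecidableEq F] {G' : Matrix (Fin k) (Fin n) F}
    (τ : Equiv.Perm (Fin n)) (c : Fin n → F) (hc : ∀ j, c j ≠ 0)
    (hG' : ∀ j, G.col (τ j) = c j • G'.col j) (x : Fin k → F) :
    wt (x ᵥ* G') = wt (x ᵥ* G) := by
  rw [wt, wt, Finset.card_filter, Finset.card_filter,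
    ← Equiv.sum_comp τ fun j => if (x ᵥ* G) j ≠ 0 then 1 else 0]
  refine Finset.sum_congr rfl fun j _ => ?_
  have : (x ᵥ* G) (τ j) = c j * (x ᵥ* G') j := by
    change x ⬝ᵥ G.col (τ j) = c j * (x ⬝ᵥ G'.col j)
    rw [hG', dotProduct_smul, smul_eq_mul]
  simp [this, hc]

lemma mul_transpose_of_col {G' : Matrix (Fin k) (Fin n) F}
    (τ : Equiv.Perm (Fin n)) (c : Fin n → F) (hc : ∀ j, c j * c j = 1)
    (hG' : ∀ j, G.col (τ j) = c j • G'.col j) : G' * G'ᵀ = G * Gᵀ := by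
  ext a b
  simp only [Matrix.mul_apply, Matrix.transpose_apply]
  rw [← Equiv.sum_comp τ fun j => G a j * G b j]
  refine Finset.sum_congr rfl fun j _ => ?_
  have h : ∀ i, G i (τ j) = c j * G' i j := fun i => congrFun (hG' j) i
  rw [h, h]
  linear_combination -(G' a j * G' b j) * hc j

end GeneratorMatrices

lemma sum_hcat {F M : Type*} [AddCommMonoid M] {k n a b : ℕ} (A : Matrix (Fin k) (Fin a) F)
    (B : Matrix (Fin k) (Fin b) F) (h : a + b = n) (f : (Fin k → F) → M) :
    ∑ j, f (((hcat A B).submatrix id (Fin.cast h.symm)).col j) =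
      ∑ j, f (A.col j) + ∑ j, f (B.col j) := by
  subst h
  rw [Fin.sum_univ_add]
  congr 1
  · refine Finset.sum_congr rfl fun j _ => congrArg f ?_
    ext i
    simp [hcat, Matrix.col]
  · refine Finset.sum_congr rfl fun j _ => congrArg f ?_
    ext i
    simp [hcat, Matrix.col]

lemma sum_reps {F M : Type*} [AddCommMonoid M] {k n : ℕ} (A : Matrix (Fin k) (Fin n) F) (s : ℕ)
    (f : (Fin k → F) → M) : ∑ j, f ((reps A s).col j) = s • ∑ j, f (A.col j) := by
  rw [← Equiv.sum_comp (finProdFinEquiv.trans (finCongr (mul_comm s n))), Fintype.sum_prod_type]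
  have : ∀ (a : Fin s) (b : Fin n),
      (reps A s).col ((finProdFinEquiv.trans (finCongr (mul_comm s n))) (a, b)) = A.col b := by
    intro a b
    ext i
    simp [reps, Matrix.col, Nat.mod_eq_of_lt]
  simp only [this, Finset.sum_const, Finset.card_univ, Fintype.card_fin]

/-- If each value of `p` is attained at least `e` times, the elements of the domain can be
reordered so that the first `m * e` values of `p` run cyclically through `Fin m`. -/
lemma exists_perm_cyclic {n m e : ℕ} (p : Fin n → Fin m)
    (hp : ∀ i, e ≤ (univ.filter fun j => p j = i).card) :
    ∃ τ : Equiv.Perm (Fin n), ∀ t : Fin n, (t : ℕ) < m * e → (p (τ t) : ℕ) = (t : ℕ) % m := by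
  have hemb : ∀ i, ∃ g : Fin e → Fin n, Function.Injective g ∧ ∀ s, p (g s) = i := by
    intro i
    obtain ⟨g⟩ := Function.Embedding.nonempty_of_card_le
      (α := Fin e) (β := {j // p j = i}) (by simpa [Fintype.card_subtype] using hp i)
    exact ⟨fun s => g s, Subtype.val_injective.comp g.injective, fun s => (g s).2⟩
  choose g hg hpg using hemb
  have hm : ∀ t : ℕ, t < m * e → t % m < m := fun t ht =>
    Nat.mod_lt _ (Nat.pos_of_mul_pos_right (Nat.zero_lt_of_lt ht))
  have hd : ∀ t : ℕ, t < m * e → t / m < e := fun t ht => Nat.div_lt_of_lt_mul ht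
  let f : Fin n → Fin n := fun t =>
    if ht : (t : ℕ) < m * e then g ⟨t % m, hm t ht⟩ ⟨t / m, hd t ht⟩ else t
  have hf : ∀ (t : Fin n) (ht : (t : ℕ) < m * e),
      f t = g ⟨t % m, hm t ht⟩ ⟨t / m, hd t ht⟩ := fun t ht => dif_pos ht
  obtain ⟨τ, hτ⟩ := Set.MapsTo.exists_equiv_extend_of_card_eq (t := (univ : Finset (Fin n)))
    (s := {t : Fin n | (t : ℕ) < m * e}) (f := f) (by simp) (fun _ _ => by simp) (by
      intro t ht t' ht' h
      have ht : (t : ℕ) < m * e := ht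
      have ht' : (t' : ℕ) < m * e := ht'
      rw [hf t ht, hf t' ht'] at h
      have hmod := congrArg p h
      rw [hpg, hpg] at hmod
      rw [hmod] at h
      have hdiv := Fin.mk.inj (hg _ h)
      have hmod := Fin.mk.inj hmod
      rw [Fin.ext_iff, ← Nat.mod_add_div t m, hmod, hdiv, Nat.mod_add_div])
  refine ⟨τ.trans (Equiv.subtypeUnivEquiv (by simp)), fun t ht => ?_⟩
  have h1 : (τ.trans (Equiv.subtypeUnivEquiv (by simp))) t = f t := hτ t ht
  rw [h1, hf t ht, hpg]

/-- Any LCD `[n,k,d]` code `C` over `𝔽_q` with dual distance `≥ 2` is equivalent to a code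
`C'` with generator matrix `(S_{q,k}^{(qd−(q−1)n)} | G₀)`, where `G₀` generates an LCD
`[q·r, k, (q−1)·r]` code, `r = r_{q,n,k,d}`. -/
theorem lcd_standard_form {q k₀ k n d e r : ℕ}
    (hq : (q = 2 ∧ k₀ = 3) ∨ (q = 3 ∧ k₀ = 2)) (hk : k₀ ≤ k)
    (he : (e : ℤ) = (q : ℤ) * d - ((q : ℤ) - 1) * n) (he1 : 1 ≤ e)
    (hr : (r : ℤ) = (q : ℤ) ^ (k - 1) * n - (qrep q k : ℤ) * d)
    (hn : qrep q k * e + q * r = n)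
    (C : Submodule (ZMod q) (Fin n → ZMod q))
    (hC : Module.finrank (ZMod q) C = k) (hlcd : IsLCD C) (hmw : HasMinWeight C d)
    (hdd : DualDistGe C 2) :
    ∃ C' : Submodule (ZMod q) (Fin n → ZMod q),
      codeEquiv C C' ∧ Module.finrank (ZMod q) C' = k ∧ IsLCD C' ∧ HasMinWeight C' d ∧
      ∃ (G₀ : Matrix (Fin k) (Fin (q * r)) (ZMod q))
        (C₀ : Submodule (ZMod q) (Fin (q * r) → ZMod q)),
        IsGenMatrix C₀ G₀ ∧ Module.finrank (ZMod q) C₀ = k ∧ IsLCD C₀ ∧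
        HasMinWeight C₀ ((q - 1) * r) ∧
        IsGenMatrix C'
          ((hcat (reps (simplexMatrix q k) e) G₀).submatrix id (Fin.cast hn.symm)) := by
  have hq3 : q = 2 ∨ q = 3 := hq.imp And.left And.left
  have hprime : q.Prime := by obtain rfl | rfl := hq3 <;> norm_num
  have : Fact q.Prime := ⟨hprime⟩
  have hk2 : 2 < (q - 1) * k := by
    obtain ⟨rfl, rfl⟩ | ⟨rfl, rfl⟩ := hq <;> omega
  have hpow : q ^ k = q * q ^ (k - 1) := by
    rw [mul_pow_sub_one]
    rintro rfl
    omega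
  have hq1 : ((q - 1 : ℕ) : ℤ) = q - 1 := by rw [Nat.cast_sub hprime.one_le, Nat.cast_one]
  obtain ⟨G, hG⟩ := exists_isGenMatrix hC
  have hcol : ∀ j, G.col j ≠ 0 := hG.col_ne_zero hdd
  have hw := (hG.hasMinWeight_iff d).1 hmw
  choose p' hp' c hc hp using fun j => exists_smul_simplexCol k (G.col j) (hcol j)
  let p : Fin n → Fin (qrep q k) := fun j => ⟨p' j, hp' j⟩
  have hmult : ∀ i, e ≤ (univ.filter fun j => p j = i).card := by
    intro i
    have h1 := multiplicity_lower_bound (fun j => G.col j) hcol hw.2 (simplexCol_ne_zero i)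
    have h2 : (univ.filter fun j => ∃ a : ZMod q, G.col j = a • simplexCol q k i).card ≤
        (univ.filter fun j => p j = i).card := by
      refine Finset.card_le_card fun j hj => ?_
      simp only [Finset.mem_filter, Finset.mem_univ, true_and] at hj ⊢
      obtain ⟨a, ha⟩ := hj
      have ha0 : a ≠ 0 := by
        rintro rfl
        exact hcol j (by rw [ha, zero_smul])
      refine eq_of_smul_simplexCol_eq (mul_ne_zero (inv_ne_zero (hc j)) ha0) ?_
      rw [mul_smul, ← ha, hp j, inv_smul_smul₀ (hc j)]
    zify at h1 h2 ⊢
    rw [hq1] at h1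
    linarith
  obtain ⟨τ, hτ⟩ := exists_perm_cyclic p hmult
  let G' : Matrix (Fin k) (Fin n) (ZMod q) := Matrix.of fun i j => simplexCol q k (p (τ j)) i
  have hG' : ∀ j, G.col (τ j) = c (τ j) • G'.col j := fun j => hp (τ j)
  let G₀ : Matrix (Fin k) (Fin (q * r)) (ZMod q) :=
    Matrix.of fun i j => G' i (Fin.cast hn (Fin.natAdd _ j))
  have hblock :
      G' = (hcat (reps (simplexMatrix q k) e) G₀).submatrix id (Fin.cast hn.symm) := by
    ext i j
    by_cases hj : (j : ℕ) < qrep q k * e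
    · simp [G', hcat, reps, simplexMatrix, hj, hτ]
    · have : Fin.cast hn (Fin.natAdd (qrep q k * e) ⟨j - qrep q k * e, by omega⟩) = j := by
        ext
        simp
        omega
      simp only [G₀, hcat, Matrix.submatrix_apply, Matrix.of_apply, id_eq, Fin.val_cast, hj,
        dif_neg, not_false_eq_true, this]
  obtain ⟨C', hCC', hC'⟩ := hG.exists_codeEquiv τ (fun j => c (τ j)) (fun j => hc _) hG'
  have hwt' := wt_vecMul_of_col τ (fun j => c (τ j)) (fun j => hc _) hG'
  have hgram' := mul_transpose_of_col τ (fun j => c (τ j))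
    (fun j => ZMod.mul_self_eq_one_of_ne_zero hq3 _ (hc _)) hG'
  have hw' : ∀ x : Fin k → ZMod q, x ≠ 0 →
      wt (x ᵥ* G') = e * q ^ (k - 1) + wt (x ᵥ* G₀) := by
    intro x hx
    have h1 := mul_card_simplexCol_dotProduct_ne_zero hx
    rw [hpow] at h1
    have h2 := Nat.eq_of_mul_eq_mul_left hprime.pos h1
    rw [Finset.card_filter] at h2
    have h3 := sum_hcat (reps (simplexMatrix q k) e) G₀ hn
      (fun v => if x ⬝ᵥ v ≠ 0 then 1 else 0)
    rw [← hblock, sum_reps _ _ fun v : Fin k → ZMod q => if x ⬝ᵥ v ≠ 0 then 1 else 0,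
      smul_eq_mul] at h3
    rw [wt, wt, Finset.card_filter, Finset.card_filter, ← h2]
    exact h3
  have hgram : G' * G'ᵀ = G₀ * G₀ᵀ := by
    ext a b
    have h3 := sum_hcat (reps (simplexMatrix q k) e) G₀ hn (fun v => v a * v b)
    rw [← hblock, sum_reps _ _ fun v : Fin k → ZMod q => v a * v b] at h3
    have h4 : ∑ j, (simplexMatrix q k).col j a * (simplexMatrix q k).col j b = 0 :=
      sum_simplexCol_mul_simplexCol (by omega) hk2 a b
    rw [h4, smul_zero, zero_add] at h3
    exact h3
  have hlcd' : ∀ x, x ᵥ* (G₀ * G₀ᵀ) = 0 → x = 0 := by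
    rw [← hgram, hgram']
    exact hG.isLCD_iff.1 hlcd
  have hC₀ : IsGenMatrix (rowSpace G₀) G₀ := by
    refine ⟨Matrix.vecMul_injective_iff.1 ?_, rfl⟩
    rw [← Matrix.coe_vecMulLinear, injective_iff_map_eq_zero]
    intro x hx
    rw [Matrix.vecMulLinear_apply] at hx
    exact hlcd' x (by rw [← Matrix.vecMul_vecMul, hx, Matrix.zero_vecMul])
  have hd : d = e * q ^ (k - 1) + (q - 1) * r := by
    have h1 := pred_mul_qrep_add_one hprime.one_le k
    rw [hpow] at h1
    zify at h1 ⊢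
    rw [hq1] at h1 ⊢
    rw [he, hr]
    linear_combination (d : ℤ) * h1
  refine ⟨C', hCC', hC'.finrank_eq, ?_, ?_, G₀, rowSpace G₀, hC₀, hC₀.finrank_eq,
    hC₀.isLCD_iff.2 hlcd', ?_, hblock ▸ hC'⟩
  · rw [hC'.isLCD_iff, hgram]
    exact hlcd'
  · rw [hC'.hasMinWeight_iff]
    simpa only [hwt'] using hw
  · rw [hC₀.hasMinWeight_iff]
    refine ⟨?_, fun x hx => ?_⟩
    · obtain ⟨x, hx, hxd⟩ := hw.1
      refine ⟨x, hx, ?_⟩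
      have := hw' x hx
      rw [hwt'] at this
      omega
    · have := hw' x hx
      have := hw.2 x hx
      rw [hwt'] at *
      omega
end
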